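/- arXiv:1312.0453 — 3 statements merged into one kernel-verified Lean document; each statement's English description precedes it below -/
import Mathlib

section
/- Let k be a field with algebraic closure k̄ and let 𝔞 ⊆ k[x₁,…,xₙ,u₁,…,uₘ] be a zero-dimensional ideal. Then a border system for 𝔞 exists: there are finitely many pairwise disjoint subsets γ₁,…,γ_L of k̄^m whose union is all of k̄^m, order ideals O₁,…,O_L ⊆ T^n, and finite sets B₁,…,B_L ⊆ k[x₁,…,xₙ,u₁,…,uₘ], such that for every ℓ and every specialization σ ∈ γ_ℓ, the image σ(B_ℓ) is a scalar O_ℓ-border basis of σ(𝔞) in k̄[x₁,…,xₙ]. -/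
open MvPolynomial

/-- An order ideal: a finite set of monomials (exponent vectors) closed under divisibility. -/
def IsOrderIdeal {n : ℕ} (O : Set (Fin n →₀ ℕ)) : Prop :=
  O.Finite ∧ ∀ β ∈ O, ∀ α : Fin n →₀ ℕ, α ≤ β → α ∈ O

/-- The border `∂O = (x₁O ∪ … ∪ xₙO) \ O`, with the convention `∂∅ = {1}`. -/
def border {n : ℕ} (O : Set (Fin n →₀ ℕ)) : Set (Fin n →₀ ℕ) :=
  {β | (O = ∅ ∧ β = 0) ∨
    (O ≠ ∅ ∧ β ∉ O ∧ ∃ i : Fin n, ∃ α ∈ O, β = α + Finsupp.single i 1)}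

/-- `g` assigns to each border monomial `b ∈ ∂O` a polynomial `g b = b − Σᵢ cᵢ tᵢ`
(`tᵢ ∈ O`); the family `{g b : b ∈ ∂O}` is the `O`-border basis of `I` when all
`g b ∈ I` and the residue classes of the elements of `O` form an `F`-vector space basis
of the quotient by `I`. -/
def IsBorderBasisFun {n : ℕ} (F : Type*) [Field F] (O : Set (Fin n →₀ ℕ))
    (I : Ideal (MvPolynomial (Fin n) F))
    (g : (Fin n →₀ ℕ) → MvPolynomial (Fin n) F) : Prop :=
  (∀ b ∈ border O, ↑(g b - monomial b (1 : F)).support ⊆ O ∧ g b ∈ I) ∧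
  LinearIndependent F
    (fun t : O => Ideal.Quotient.mk I (monomial (t : Fin n →₀ ℕ) (1 : F))) ∧
  Submodule.span F
    (Set.range fun t : O => Ideal.Quotient.mk I (monomial (t : Fin n →₀ ℕ) (1 : F))) = ⊤

/-- `B` is the `O`-border basis of `I`. -/
def IsBorderBasis {n : ℕ} (F : Type*) [Field F] (O : Set (Fin n →₀ ℕ))
    (I : Ideal (MvPolynomial (Fin n) F)) (B : Set (MvPolynomial (Fin n) F)) : Prop :=
  ∃ g, IsBorderBasisFun F O I g ∧ B = g '' border O

/-- `B'` is a scalar `O`-border basis of `I`: `B' = {c_b • g b : b ∈ ∂O}` with all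
`c_b ≠ 0` and `{g b : b ∈ ∂O}` the `O`-border basis of `I`. -/
def IsScalarBorderBasis {n : ℕ} (F : Type*) [Field F] (O : Set (Fin n →₀ ℕ))
    (I : Ideal (MvPolynomial (Fin n) F)) (B' : Set (MvPolynomial (Fin n) F)) : Prop :=
  ∃ (g : (Fin n →₀ ℕ) → MvPolynomial (Fin n) F) (c : (Fin n →₀ ℕ) → F),
    IsBorderBasisFun F O I g ∧ (∀ b ∈ border O, c b ≠ 0) ∧
    B' = (fun b => c b • g b) '' border O

/-- The specialization `σ = (c₁,…,cₘ) ∈ K^m`: the `k`-algebra homomorphism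
`k[x₁,…,xₙ,u₁,…,uₘ] → K[x₁,…,xₙ]` sending `xᵢ ↦ xᵢ` and `uⱼ ↦ cⱼ`. -/
noncomputable def specialize (k K : Type*) [Field k] [Field K] [Algebra k K]
    (n m : ℕ) (σ : Fin m → K) :
    MvPolynomial (Fin n ⊕ Fin m) k →+* MvPolynomial (Fin n) K :=
  (aeval (Sum.elim X (fun j => C (σ j)))).toRingHom

lemma span_range_monomial_subtype {n : ℕ} (F : Type*) [Field F] (O : Set (Fin n →₀ ℕ)) :
    Submodule.span F (Set.range fun t : O => monomial (t : Fin n →₀ ℕ) (1 : F)) =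
      restrictSupport F O := by
  rw [restrictSupport_eq_span]
  congr 1
  ext
  simp

lemma linearIndependent_mk_monomial {n : ℕ} {F : Type*} [Field F] {O : Set (Fin n →₀ ℕ)}
    {I : Ideal (MvPolynomial (Fin n) F)}
    (h : Disjoint (restrictSupport F O) (I.restrictScalars F)) :
    LinearIndependent F
      (fun t : O => Ideal.Quotient.mk I (monomial (t : Fin n →₀ ℕ) (1 : F))) := by
  have hli : LinearIndependent F (fun t : O => monomial (t : Fin n →₀ ℕ) (1 : F)) := by
    simpa [Function.comp_def] using
      (basisMonomials (Fin n) F).linearIndependent.comp (Subtype.val : O → _)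
        Subtype.val_injective
  refine hli.map (f := (Ideal.Quotient.mkₐ F I).toLinearMap) ?_
  rw [span_range_monomial_subtype]
  convert h using 1
  ext f
  simp [Ideal.Quotient.eq_zero_iff_mem]

lemma isBorderBasisFun_of_isCompl {n : ℕ} {F : Type*} [Field F] {O : Set (Fin n →₀ ℕ)}
    {I : Ideal (MvPolynomial (Fin n) F)} {g : (Fin n →₀ ℕ) → MvPolynomial (Fin n) F}
    (h : IsCompl (restrictSupport F O) (I.restrictScalars F))
    (hg : ∀ b ∈ border O, ↑(g b - monomial b (1 : F)).support ⊆ O ∧ g b ∈ I) :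
    IsBorderBasisFun F O I g := by
  refine ⟨hg, linearIndependent_mk_monomial h.disjoint, ?_⟩
  have hr : (Set.range fun t : O => Ideal.Quotient.mk I (monomial (t : Fin n →₀ ℕ) (1 : F))) =
      (Ideal.Quotient.mkₐ F I).toLinearMap ''
        Set.range fun t : O => monomial (t : Fin n →₀ ℕ) (1 : F) := by
    rw [← Set.range_comp]
    rfl
  rw [hr, ← Submodule.map_span, span_range_monomial_subtype, eq_top_iff]
  rintro x -
  obtain ⟨f, rfl⟩ := Ideal.Quotient.mk_surjective x
  obtain ⟨p, hp, q, hq, rfl⟩ := Submodule.mem_sup.1 (h.sup_eq_top ▸ Submodule.mem_top (x := f))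
  refine ⟨p, hp, ?_⟩
  have hq0 : Ideal.Quotient.mk I q = 0 := Ideal.Quotient.eq_zero_iff_mem.2 hq
  simp [hq0]

/-- The standard monomials of a zero-dimensional ideal with respect to a monomial order form an
order ideal spanning a complement of the ideal. -/
lemma exists_isOrderIdeal_isCompl {n : ℕ} {F : Type*} [Field F]
    (I : Ideal (MvPolynomial (Fin n) F)) [FiniteDimensional F (MvPolynomial (Fin n) F ⧸ I)] :
    ∃ O : Set (Fin n →₀ ℕ), IsOrderIdeal O ∧
      IsCompl (restrictSupport F O) (I.restrictScalars F) := by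
  let M : MonomialOrder (Fin n) := MonomialOrder.lex
  let O : Set (Fin n →₀ ℕ) := {a | ∀ f ∈ I, f ≠ 0 → M.degree f ≠ a}
  have hdisj : Disjoint (restrictSupport F O) (I.restrictScalars F) := by
    rw [Submodule.disjoint_def]
    intro f hf hfI
    by_contra hf0
    exact ((mem_restrictSupport_iff _).1 hf) (M.degree_mem_support hf0) f hfI hf0 rfl
  have hmon : ∀ (a : Fin n →₀ ℕ) (c : F),
      monomial a c ∈ restrictSupport F O ⊔ I.restrictScalars F := by
    suffices H : ∀ (s : M.syn) (a : Fin n →₀ ℕ), M.toSyn a = s → ∀ c : F,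
        monomial a c ∈ restrictSupport F O ⊔ I.restrictScalars F from
      fun a c => H _ a rfl c
    intro s
    induction s using WellFoundedLT.induction with
    | ind s ih =>
      rintro a rfl c
      by_cases ha : a ∈ O
      · exact Submodule.mem_sup_left (by simp [ha])
      · obtain ⟨f, hfI, hf0, rfl⟩ : ∃ f ∈ I, f ≠ 0 ∧ M.degree f = a := by
          simpa [O] using ha
        have hlc : f.coeff (M.degree f) ≠ 0 := M.leadingCoeff_ne_zero_iff.2 hf0
        set d := c / f.coeff (M.degree f) with hd
        have key : monomial (M.degree f) c =
            d • f - ∑ b ∈ f.support.erase (M.degree f), monomial b (d * f.coeff b) := by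
          rw [eq_sub_iff_add_eq]
          conv_rhs => rw [f.as_sum, Finset.smul_sum]
          rw [← Finset.add_sum_erase _ _ (M.degree_mem_support hf0)]
          simp [smul_monomial, hd, hlc]
        rw [key]
        refine sub_mem (Submodule.mem_sup_right
          ((I.restrictScalars F).smul_mem d hfI)) (sum_mem fun b hb => ?_)
        rw [Finset.mem_erase] at hb
        refine ih _ (lt_of_le_of_ne (M.le_degree hb.2) ?_) b rfl _
        exact fun h => hb.1 (M.toSyn.injective h)
  have hcompl : IsCompl (restrictSupport F O) (I.restrictScalars F) := by
    refine ⟨hdisj, codisjoint_iff.2 (eq_top_iff.2 fun f _ => ?_)⟩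
    rw [f.as_sum]
    exact sum_mem fun a _ => hmon a _
  refine ⟨O, ⟨?_, ?_⟩, hcompl⟩
  · have := (linearIndependent_mk_monomial hdisj).finite_of_isNoetherian
    exact Set.toFinite O
  · rintro _ hb a hab f hfI hf0 rfl
    obtain ⟨c, rfl⟩ := exists_add_of_le hab
    have h1 : monomial c (1 : F) ≠ 0 := by simp
    refine hb (monomial c 1 * f) (I.mul_mem_left _ hfI) (mul_ne_zero h1 hf0) ?_
    classical
    rw [M.degree_mul h1 hf0, M.degree_monomial, if_neg one_ne_zero, add_comm]

lemma border_finite {n : ℕ} {O : Set (Fin n →₀ ℕ)} (hO : O.Finite) : (border O).Finite := by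
  refine ((Set.finite_singleton 0).union (Set.finite_iUnion fun i : Fin n =>
    hO.image fun α => α + Finsupp.single i 1)).subset ?_
  rintro β (⟨-, rfl⟩ | ⟨-, -, i, α, hα, rfl⟩)
  · simp
  · exact Or.inr (Set.mem_iUnion.2 ⟨i, α, hα, rfl⟩)

/-- A linear functional on the coefficients, applied coefficientwise. -/
noncomputable def coeffwise {ι F K : Type*} [Field F] [Field K] [Algebra F K]
    (l : K →ₗ[F] F) : MvPolynomial ι K →+ MvPolynomial ι F :=
  (basisMonomials ι F).repr.symm.toLinearMap.toAddMonoidHom.comp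
    ((Finsupp.mapRange.addMonoidHom l.toAddMonoidHom).comp
      (basisMonomials ι K).repr.toLinearMap.toAddMonoidHom)

lemma coeffwise_monomial {ι F K : Type*} [Field F] [Field K] [Algebra F K]
    (l : K →ₗ[F] F) (a : ι →₀ ℕ) (c : K) :
    coeffwise l (monomial a c) = monomial a (l c) := by
  have h : (basisMonomials ι K).repr (monomial a c) = Finsupp.single a c := by
    have h1 : monomial a c = c • basisMonomials ι K a := by simp [smul_monomial]
    rw [h1, map_smul, Module.Basis.repr_self]
    simp
  simp [coeffwise, h, smul_monomial]

lemma coeff_coeffwise {ι F K : Type*} [Field F] [Field K] [Algebra F K]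
    (l : K →ₗ[F] F) (f : MvPolynomial ι K) (a : ι →₀ ℕ) :
    (coeffwise l f).coeff a = l (f.coeff a) := by
  classical
  induction f using MvPolynomial.induction_on' with
  | monomial b c => simp [coeffwise_monomial, coeff_monomial, apply_ite l]
  | add p q hp hq => simp [hp, hq]

lemma coeffwise_mul_map {ι F K : Type*} [Field F] [Field K] [Algebra F K]
    (l : K →ₗ[F] F) (p : MvPolynomial ι K) (q : MvPolynomial ι F) :
    coeffwise l (p * map (algebraMap F K) q) = coeffwise l p * q := by
  classical
  ext a
  simp only [coeff_coeffwise, coeff_mul, coeff_map, map_sum]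
  refine Finset.sum_congr rfl fun x _ => ?_
  rw [mul_comm, ← Algebra.smul_def, map_smul, smul_eq_mul, mul_comm]

lemma coeffwise_mem {ι F K : Type*} [Field F] [Field K] [Algebra F K]
    (l : K →ₗ[F] F) {I : Ideal (MvPolynomial ι F)} {f : MvPolynomial ι K}
    (hf : f ∈ I.map (map (algebraMap F K))) : coeffwise l f ∈ I := by
  refine Submodule.span_induction ?_ ?_ ?_ ?_ (p := fun f _ => ∀ p, coeffwise l (p * f) ∈ I) hf 1
    |> fun h => by simpa using h
  · rintro _ ⟨q, hq, rfl⟩ p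
    rw [coeffwise_mul_map]
    exact I.mul_mem_left _ hq
  · simp
  · intro x y _ _ hx hy p
    rw [mul_add, map_add]
    exact I.add_mem (hx p) (hy p)
  · intro r x _ hx p
    rw [smul_eq_mul, ← mul_assoc]
    exact hx _

/-- Complements spanned by monomials are preserved under extension of the ground field. -/
lemma isCompl_restrictSupport_map {n : ℕ} {F K : Type*} [Field F] [Field K] [Algebra F K]
    {O : Set (Fin n →₀ ℕ)} {I : Ideal (MvPolynomial (Fin n) F)}
    (h : IsCompl (restrictSupport F O) (I.restrictScalars F)) :
    IsCompl (restrictSupport K O)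
      ((I.map (map (σ := Fin n) (algebraMap F K))).restrictScalars K) := by
  constructor
  · rw [Submodule.disjoint_def]
    intro f hf hfI
    ext a
    rw [coeff_zero]
    by_contra hne
    obtain ⟨l, hl⟩ : ∃ l : Module.Dual F K, l (f.coeff a) ≠ 0 := by
      by_contra! hl
      exact hne ((Module.forall_dual_apply_eq_zero_iff F _).1 hl)
    refine hl ?_
    rw [← coeff_coeffwise, Submodule.disjoint_def.1 h.disjoint _ ?_ (coeffwise_mem l hfI),
      coeff_zero]
    refine (mem_restrictSupport_iff _).2 fun b hb => (mem_restrictSupport_iff _).1 hf ?_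
    rw [Finset.mem_coe, mem_support_iff, coeff_coeffwise] at hb
    rw [Finset.mem_coe, mem_support_iff]
    exact fun h0 => hb (by rw [h0, map_zero])
  · refine codisjoint_iff.2 (eq_top_iff.2 fun f _ => ?_)
    rw [f.as_sum]
    refine sum_mem fun a _ => ?_
    obtain ⟨p, hp, q, hq, hpq⟩ := Submodule.mem_sup.1
      (h.sup_eq_top ▸ Submodule.mem_top (x := monomial a (1 : F)))
    have hm : monomial a (f.coeff a) = f.coeff a • map (algebraMap F K) p +
        f.coeff a • map (algebraMap F K) q := by
      rw [← smul_add, ← map_add, hpq, map_monomial, map_one, smul_monomial, smul_eq_mul, mul_one]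
    rw [hm]
    refine Submodule.add_mem_sup (Submodule.smul_mem _ _ ?_)
      (Submodule.smul_mem _ _ (Ideal.mem_map_of_mem _ hq))
    exact (mem_restrictSupport_iff _).2
      ((Finset.coe_subset.2 (support_map_subset _ p)).trans ((mem_restrictSupport_iff _).1 hp))

/-- If a specialization factors through a field `F` onto which the parameters map surjectively,
then the specialized ideal has a border basis that lifts along the specialization. -/
lemma exists_lift_border_basis_of_surjective {n m : ℕ} {k F K : Type*} [Field k] [Field F]
    [Field K] [Algebra k F] [Algebra F K] [Algebra k K] [IsScalarTower k F K]
    (𝔞 : Ideal (MvPolynomial (Fin n ⊕ Fin m) k))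
    [FiniteDimensional k (MvPolynomial (Fin n ⊕ Fin m) k ⧸ 𝔞)] (τ : Fin m → F)
    (hτ : Function.Surjective (aeval τ : MvPolynomial (Fin m) k →ₐ[k] F)) :
    ∃ (O : Set (Fin n →₀ ℕ)) (B : Set (MvPolynomial (Fin n ⊕ Fin m) k)),
      IsOrderIdeal O ∧ B.Finite ∧
      IsScalarBorderBasis K O (Ideal.map (specialize k K n m (algebraMap F K ∘ τ)) 𝔞)
        (specialize k K n m (algebraMap F K ∘ τ) '' B) := by
  let φ := specialize k F n m τ
  have hcomp : specialize k K n m (algebraMap F K ∘ τ) = (map (algebraMap F K)).comp φ := by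
    ext i
    · simp [specialize, φ, MvPolynomial.algebraMap_apply, ← IsScalarTower.algebraMap_apply]
    · rcases i with i | i <;> simp [specialize, φ]
  have hsurj : Function.Surjective φ := by
    intro f
    induction f using MvPolynomial.induction_on with
    | C c =>
      obtain ⟨p, rfl⟩ := hτ c
      refine ⟨rename Sum.inr p, ?_⟩
      have : φ (rename Sum.inr p) = aeval (fun j => C (τ j)) p := by
        simp [φ, specialize, aeval_rename, Function.comp_def]
      rw [this, ← MvPolynomial.algebraMap_eq]
      exact aeval_algebraMap_apply _ τ p
    | add p q hp hq =>
      obtain ⟨a, rfl⟩ := hp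
      obtain ⟨b, rfl⟩ := hq
      exact ⟨a + b, map_add _ _ _⟩
    | mul_X p i hp =>
      obtain ⟨a, rfl⟩ := hp
      exact ⟨a * X (Sum.inl i), by simp [φ, specialize]⟩
  have hfin : FiniteDimensional F (MvPolynomial (Fin n) F ⧸ 𝔞.map φ) := by
    have : Module.Finite k (MvPolynomial (Fin n) F ⧸ 𝔞.map φ) := by
      let ψ : MvPolynomial (Fin n ⊕ Fin m) k →ₐ[k] MvPolynomial (Fin n) F :=
        aeval (Sum.elim X (fun j => C (τ j)))
      refine Module.Finite.of_surjective
        (Ideal.quotientMapₐ (𝔞.map φ) ψ Ideal.le_comap_map).toLinearMap ?_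
      exact Ideal.quotientMap_surjective (H := Ideal.le_comap_map (f := φ)) hsurj
    exact Module.Finite.of_restrictScalars_finite k F _
  obtain ⟨O, hO, hcompl⟩ := exists_isOrderIdeal_isCompl (𝔞.map φ)
  have hdec : ∀ b : Fin n →₀ ℕ, ∃ g : MvPolynomial (Fin n ⊕ Fin m) k,
      φ g ∈ 𝔞.map φ ∧ φ g - monomial b 1 ∈ restrictSupport F O := by
    intro b
    obtain ⟨p, hp, q, hq, hpq⟩ := Submodule.mem_sup.1
      (hcompl.sup_eq_top ▸ Submodule.mem_top (x := monomial b (1 : F)))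
    obtain ⟨g, rfl⟩ := hsurj q
    refine ⟨g, hq, ?_⟩
    rw [← hpq, sub_add_cancel_right]
    exact neg_mem hp
  choose g hgI hgO using hdec
  refine ⟨O, g '' border O, hO, (border_finite hO.1).image g,
    fun b => map (algebraMap F K) (φ (g b)), 1, ?_, by simp, ?_⟩
  · rw [hcomp, ← Ideal.map_map]
    refine isBorderBasisFun_of_isCompl (isCompl_restrictSupport_map hcompl) fun b _ =>
      ⟨?_, Ideal.mem_map_of_mem _ (hgI b)⟩
    have : map (algebraMap F K) (φ (g b)) - monomial b 1 =
        map (algebraMap F K) (φ (g b) - monomial b 1) := by simp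
    rw [this]
    exact (Finset.coe_subset.2 (support_map_subset _ _)).trans
      ((mem_restrictSupport_iff _).1 (hgO b))
  · rw [hcomp, Set.image_image]
    simp

lemma exists_lift_border_basis {n m : ℕ} {k K : Type*} [Field k] [Field K] [Algebra k K]
    [Algebra.IsAlgebraic k K] (𝔞 : Ideal (MvPolynomial (Fin n ⊕ Fin m) k))
    [FiniteDimensional k (MvPolynomial (Fin n ⊕ Fin m) k ⧸ 𝔞)] (σ : Fin m → K) :
    ∃ (O : Set (Fin n →₀ ℕ)) (B : Set (MvPolynomial (Fin n ⊕ Fin m) k)),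
      IsOrderIdeal O ∧ B.Finite ∧
      IsScalarBorderBasis K O (Ideal.map (specialize k K n m σ) 𝔞)
        (specialize k K n m σ '' B) := by
  let F : IntermediateField k K := (aeval σ : MvPolynomial (Fin m) k →ₐ[k] K).range
    |>.toIntermediateField' (Subalgebra.isField_of_algebraic _)
  let τ : Fin m → F := fun j => ⟨σ j, X j, by simp⟩
  refine exists_lift_border_basis_of_surjective (F := F) 𝔞 τ ?_
  rintro ⟨_, p, rfl⟩
  refine ⟨p, Subtype.ext ?_⟩
  have : algebraMap F K (aeval τ p) = aeval (algebraMap F K ∘ τ) p :=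
    (aeval_algebraMap_apply K τ p).symm
  exact this

lemma finite_setOf_map_specialize_ne_top {n m : ℕ} {k K : Type*} [Field k] [Field K] [Algebra k K]
    (𝔞 : Ideal (MvPolynomial (Fin n ⊕ Fin m) k))
    [FiniteDimensional k (MvPolynomial (Fin n ⊕ Fin m) k ⧸ 𝔞)] :
    {σ : Fin m → K | Ideal.map (specialize k K n m σ) 𝔞 ≠ ⊤}.Finite := by
  have hp : ∀ j : Fin m, ∃ p : Polynomial k, p ≠ 0 ∧
      Polynomial.aeval (X (Sum.inr j) : MvPolynomial (Fin n ⊕ Fin m) k) p ∈ 𝔞 := by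
    intro j
    obtain ⟨p, hp0, hp⟩ := Algebra.IsAlgebraic.isAlgebraic (R := k)
      (Ideal.Quotient.mkₐ k 𝔞 (X (Sum.inr j)))
    refine ⟨p, hp0, ?_⟩
    rw [Polynomial.aeval_algHom_apply] at hp
    exact Ideal.Quotient.eq_zero_iff_mem.1 hp
  choose p hp0 hp𝔞 using hp
  refine (Set.Finite.pi' fun j => (p j).rootSet_finite K).subset fun σ hσ j => ?_
  rw [Polynomial.mem_rootSet]
  refine ⟨hp0 j, ?_⟩
  by_contra hne
  refine hσ (Ideal.eq_top_of_isUnit_mem _ (Ideal.mem_map_of_mem _ (hp𝔞 j)) ?_)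
  have : specialize k K n m σ (Polynomial.aeval (X (Sum.inr j)) (p j)) =
      C (Polynomial.aeval (σ j) (p j)) := by
    change (aeval (Sum.elim X (fun j => C (σ j))) : _ →ₐ[k] MvPolynomial (Fin n) K) _ = _
    rw [← Polynomial.aeval_algHom_apply, aeval_X, Sum.elim_inr, ← MvPolynomial.algebraMap_eq,
      Polynomial.aeval_algebraMap_apply]
  rw [this]
  exact (isUnit_iff_ne_zero.2 hne).map C

lemma isScalarBorderBasis_empty {n : ℕ} (F : Type*) [Field F] :
    IsScalarBorderBasis F ∅ (⊤ : Ideal (MvPolynomial (Fin n) F)) {1} := by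
  have hb : border (∅ : Set (Fin n →₀ ℕ)) = {0} := by
    ext
    simp [border]
  refine ⟨1, 1, isBorderBasisFun_of_isCompl ?_ ?_, by simp, by simp [hb]⟩
  · have : restrictSupport F (∅ : Set (Fin n →₀ ℕ)) = ⊥ := by
      simp [restrictSupport_eq_span]
    rw [this, Submodule.restrictScalars_top]
    exact isCompl_bot_top
  · simp [hb]

/-- for a zero-dimensional ideal `𝔞 ⊆ k[x₁,…,xₙ,u₁,…,uₘ]`, a border system
for `𝔞` exists: there are finitely many pairwise disjoint subsets `γ₁,…,γ_L` of `k̄^m`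
covering all of `k̄^m`, order ideals `O₁,…,O_L`, and finite sets
`B₁,…,B_L ⊆ k[x₁,…,xₙ,u₁,…,uₘ]`, such that for every `ℓ` and every specialization
`σ ∈ γ_ℓ`, `σ(B_ℓ)` is a scalar `O_ℓ`-border basis of `σ(𝔞)` in `k̄[x₁,…,xₙ]`. -/
theorem exists_border_system
    {n m : ℕ} (k K : Type*) [Field k] [Field K] [Algebra k K] [IsAlgClosure k K]
    (𝔞 : Ideal (MvPolynomial (Fin n ⊕ Fin m) k))
    (h0 : FiniteDimensional k (MvPolynomial (Fin n ⊕ Fin m) k ⧸ 𝔞)) :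
    ∃ (L : ℕ) (γ : Fin L → Set (Fin m → K)) (O : Fin L → Set (Fin n →₀ ℕ))
      (B : Fin L → Set (MvPolynomial (Fin n ⊕ Fin m) k)),
      (∀ i j, i ≠ j → Disjoint (γ i) (γ j)) ∧
      (⋃ i, γ i) = Set.univ ∧
      (∀ ℓ, IsOrderIdeal (O ℓ)) ∧
      (∀ ℓ, (B ℓ).Finite) ∧
      (∀ ℓ, ∀ σ ∈ γ ℓ,
        IsScalarBorderBasis K (O ℓ) (Ideal.map (specialize k K n m σ) 𝔞)
          ((specialize k K n m σ) '' B ℓ)) := by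
  have : Algebra.IsAlgebraic k K := IsAlgClosure.isAlgebraic
  let S : Set (Fin m → K) := {σ | Ideal.map (specialize k K n m σ) 𝔞 ≠ ⊤}
  have hS : Finite S := finite_setOf_map_specialize_ne_top 𝔞
  choose O B hO hB hOB using fun σ : Fin m → K => exists_lift_border_basis 𝔞 σ
  obtain ⟨L, ⟨e⟩⟩ := Finite.exists_equiv_fin (Option S)
  let γ : Option S → Set (Fin m → K) := fun s => s.elim Sᶜ fun σ => {σ.1}
  let O' : Option S → Set (Fin n →₀ ℕ) := fun s => s.elim ∅ fun σ => O σ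
  let B' : Option S → Set (MvPolynomial (Fin n ⊕ Fin m) k) := fun s => s.elim {1} fun σ => B σ
  have hdisj : ∀ s t, s ≠ t → Disjoint (γ s) (γ t) := by
    rintro (_ | s) (_ | t) hst
    · exact absurd rfl hst
    · simp [γ]
    · simp [γ]
    · simpa [γ, Subtype.ext_iff, eq_comm] using hst
  have hO' : ∀ s, IsOrderIdeal (O' s) := by
    rintro (_ | s)
    · exact ⟨Set.finite_empty, by simp [O']⟩
    · exact hO s
  have hB' : ∀ s, (B' s).Finite := by
    rintro (_ | s)
    · exact Set.finite_singleton 1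
    · exact hB s
  have hOB' : ∀ s, ∀ σ ∈ γ s, IsScalarBorderBasis K (O' s)
      (Ideal.map (specialize k K n m σ) 𝔞) (specialize k K n m σ '' B' s) := by
    rintro (_ | s) σ hσ
    · have htop : Ideal.map (specialize k K n m σ) 𝔞 = ⊤ := not_not.1 hσ
      simpa [htop, O', B'] using isScalarBorderBasis_empty K
    · obtain rfl : σ = s := hσ
      exact hOB s
  refine ⟨L, γ ∘ e.symm, O' ∘ e.symm, B' ∘ e.symm,
    fun i j hij => hdisj _ _ (e.symm.injective.ne hij),
    Set.eq_univ_of_forall fun σ => Set.mem_iUnion.2 ?_, fun _ => hO' _, fun _ => hB' _,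
    fun _ => hOB' _⟩
  by_cases hσ : σ ∈ S
  · exact ⟨e (some ⟨σ, hσ⟩), by simp [γ]⟩
  · exact ⟨e none, by simpa [γ] using hσ⟩
end

section
/- Let k be a field, ≤ a monomial order on the monomials of x₁,…,xₙ, and 𝔞 ⊆ k[x₁,…,xₙ] a proper zero-dimensional ideal. Let O = O_≤(𝔞) be the set of monomials not lying in LT_≤(𝔞). Then the residue classes of the elements of O form a k-vector space basis of k[x₁,…,xₙ]/𝔞, and there exists exactly one O-border basis of 𝔞. -/
open MvPolynomial

/-- The leading monomial (exponent vector) of `f` with respect to the monomial order `m`: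
the maximum, for `m`, of the support of `f` (it is `0` when `f = 0`). -/
noncomputable def leadMonomial {n : ℕ} (m : MonomialOrder (Fin n)) {k : Type*}
    [CommSemiring k] (f : MvPolynomial (Fin n) k) : Fin n →₀ ℕ :=
  m.toSyn.symm (f.support.sup fun α => m.toSyn α)

/-- The leading term ideal `LT_≤(I)`, generated by the leading monomials of the nonzero
elements of `I`. -/
noncomputable def leadingTermIdeal {n : ℕ} (m : MonomialOrder (Fin n)) {k : Type*}
    [Field k] (I : Ideal (MvPolynomial (Fin n) k)) : Ideal (MvPolynomial (Fin n) k) :=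
  Ideal.span {p | ∃ f ∈ I, f ≠ 0 ∧ p = monomial (leadMonomial m f) (1 : k)}

/-- `O_≤(I)`: the set of monomials not belonging to the leading term ideal of `I`. -/
noncomputable def complementLT {n : ℕ} (m : MonomialOrder (Fin n)) {k : Type*}
    [Field k] (I : Ideal (MvPolynomial (Fin n) k)) : Set (Fin n →₀ ℕ) :=
  {α | (monomial α (1 : k) : MvPolynomial (Fin n) k) ∉ leadingTermIdeal m I}

section

variable {n : ℕ} {k : Type*} [Field k] {m : MonomialOrder (Fin n)}
  {I : Ideal (MvPolynomial (Fin n) k)}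

theorem mem_complementLT_iff {α : Fin n →₀ ℕ} :
    α ∈ complementLT m I ↔ ∀ f ∈ I, f ≠ 0 → ¬ m.degree f ≤ α := by
  classical
  have hset : {p | ∃ f ∈ I, f ≠ 0 ∧ p = monomial (leadMonomial m f) (1 : k)} =
      (fun s => monomial s (1 : k)) '' {s | ∃ f ∈ I, f ≠ 0 ∧ m.degree f = s} := by
    ext p
    constructor
    · rintro ⟨f, hf, h0, rfl⟩
      exact ⟨_, ⟨f, hf, h0, rfl⟩, rfl⟩
    · rintro ⟨_, ⟨f, hf, h0, rfl⟩, rfl⟩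
      exact ⟨f, hf, h0, rfl⟩
  rw [complementLT, Set.mem_ofPred_eq, leadingTermIdeal, hset, mem_ideal_span_monomial_image,
    support_monomial, if_neg one_ne_zero]
  simp only [Finset.mem_singleton, forall_eq, Set.mem_ofPred_eq]
  push Not
  constructor
  · exact fun h f hf h0 => h _ ⟨f, hf, h0, rfl⟩
  · rintro h _ ⟨f, hf, h0, rfl⟩
    exact h f hf h0

theorem eq_zero_of_support_subset_complementLT {f : MvPolynomial (Fin n) k} (hf : f ∈ I)
    (hs : ↑f.support ⊆ complementLT m I) : f = 0 := by
  by_contra h0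
  exact mem_complementLT_iff.1 (hs (m.degree_mem_support h0)) f hf h0 le_rfl

theorem exists_normalForm (m : MonomialOrder (Fin n)) (I : Ideal (MvPolynomial (Fin n) k))
    (f : MvPolynomial (Fin n) k) :
    ∃ r : MvPolynomial (Fin n) k, ↑r.support ⊆ complementLT m I ∧ f - r ∈ I := by
  obtain ⟨g, r, hfr, -, hr⟩ := m.div_set (B := {b | b ∈ I ∧ b ≠ 0})
    (fun b hb => m.isUnit_leadingCoeff.2 hb.2) f
  refine ⟨r, fun c hc => mem_complementLT_iff.2 fun b hb h0 => hr c hc b ⟨hb, h0⟩, ?_⟩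
  rw [hfr, add_sub_cancel_right, Finsupp.linearCombination_apply]
  exact I.sum_mem fun b _ => I.mul_mem_left _ b.2.1

theorem linearIndependent_complementLT (m : MonomialOrder (Fin n))
    (I : Ideal (MvPolynomial (Fin n) k)) :
    LinearIndependent k
      (fun t : complementLT m I =>
        Ideal.Quotient.mk I (monomial (t : Fin n →₀ ℕ) (1 : k))) := by
  have hmon : LinearIndependent k
      (fun t : complementLT m I => monomial (t : Fin n →₀ ℕ) (1 : k)) := by
    have h := (basisMonomials (Fin n) k).linearIndependent.comp
      (Subtype.val : complementLT m I → Fin n →₀ ℕ) Subtype.val_injective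
    rwa [coe_basisMonomials] at h
  refine hmon.map (f := (Ideal.Quotient.mkₐ k I).toLinearMap) ?_
  rw [← Set.image_eq_range (fun t => monomial t (1 : k)), ← restrictSupport_eq_span,
    Submodule.disjoint_def]
  exact fun f hf hfI => eq_zero_of_support_subset_complementLT
    (Ideal.Quotient.eq_zero_iff_mem.1 hfI) hf

theorem span_complementLT (m : MonomialOrder (Fin n)) (I : Ideal (MvPolynomial (Fin n) k)) :
    Submodule.span k
      (Set.range fun t : complementLT m I =>
        Ideal.Quotient.mk I (monomial (t : Fin n →₀ ℕ) (1 : k))) = ⊤ := by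
  rw [eq_top_iff]
  intro x _
  obtain ⟨f, rfl⟩ := Ideal.Quotient.mk_surjective x
  obtain ⟨r, hr, hfr⟩ := exists_normalForm m I f
  have hmem : r ∈ restrictSupport k (complementLT m I) := hr
  rw [restrictSupport_eq_span] at hmem
  have himage := Submodule.mem_map_of_mem (f := (Ideal.Quotient.mkₐ k I).toLinearMap) hmem
  rw [Submodule.map_span, Set.image_image, Set.image_eq_range] at himage
  rw [Ideal.Quotient.eq.2 hfr]
  exact himage

theorem IsBorderBasisFun.eqOn {g g' : (Fin n →₀ ℕ) → MvPolynomial (Fin n) k}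
    (hg : IsBorderBasisFun k (complementLT m I) I g)
    (hg' : IsBorderBasisFun k (complementLT m I) I g') :
    Set.EqOn g g' (border (complementLT m I)) := by
  intro b hb
  obtain ⟨hs, hI⟩ := hg.1 b hb
  obtain ⟨hs', hI'⟩ := hg'.1 b hb
  refine sub_eq_zero.1 (eq_zero_of_support_subset_complementLT (m := m) (I.sub_mem hI hI') ?_)
  rw [← mem_restrictSupport_iff (R := k)] at hs hs' ⊢
  simpa using Submodule.sub_mem _ hs hs'

theorem exists_isBorderBasisFun (m : MonomialOrder (Fin n))
    (I : Ideal (MvPolynomial (Fin n) k)) :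
    ∃ g, IsBorderBasisFun k (complementLT m I) I g := by
  choose r hr hI using fun b => exists_normalForm m I (monomial b (1 : k))
  refine ⟨fun b => monomial b 1 - r b, fun b _ => ⟨?_, hI b⟩,
    linearIndependent_complementLT m I, span_complementLT m I⟩
  rw [sub_sub_cancel_left, support_neg]
  exact hr b

end

/-- let `≤` be a monomial order, `𝔞 ⊆ k[x₁,…,xₙ]` a proper
zero-dimensional ideal, and `O = O_≤(𝔞)` the set of monomials not lying in `LT_≤(𝔞)`.
Then the residue classes of the elements of `O` form a `k`-vector space basis of
`k[x₁,…,xₙ]/𝔞`, and there exists exactly one `O`-border basis of `𝔞`. -/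
theorem residue_classes_basis_and_unique_border_basis
    {n : ℕ} (k : Type*) [Field k] (m : MonomialOrder (Fin n))
    (I : Ideal (MvPolynomial (Fin n) k)) (hproper : I ≠ ⊤)
    (h0 : FiniteDimensional k (MvPolynomial (Fin n) k ⧸ I)) :
    LinearIndependent k
      (fun t : complementLT m I =>
        Ideal.Quotient.mk I (monomial (t : Fin n →₀ ℕ) (1 : k))) ∧
    Submodule.span k
      (Set.range fun t : complementLT m I =>
        Ideal.Quotient.mk I (monomial (t : Fin n →₀ ℕ) (1 : k))) = ⊤ ∧
    ∃! B : Set (MvPolynomial (Fin n) k), IsBorderBasis k (complementLT m I) I B := by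
  refine ⟨linearIndependent_complementLT m I, span_complementLT m I, ?_⟩
  obtain ⟨g, hg⟩ := exists_isBorderBasisFun m I
  refine ⟨g '' border (complementLT m I), ⟨g, hg, rfl⟩, ?_⟩
  rintro _ ⟨g', hg', rfl⟩
  exact (hg'.eqOn hg).image_eq
end

section
/- Let k be a field, ≤ a monomial order on the monomials of x₁,…,xₙ, and 𝔞 ⊆ k[x₁,…,xₙ] a proper zero-dimensional ideal, with O = O_≤(𝔞) the set of monomials not lying in LT_≤(𝔞). If B is the O-border basis of 𝔞, then B is a Gröbner basis of 𝔞 with respect to ≤, i.e. the ideal generated by {LM_≤(g) : g ∈ B} equals LT_≤(𝔞). -/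
open MvPolynomial

theorem notMem_of_mem_border {n : ℕ} {O : Set (Fin n →₀ ℕ)} {b : Fin n →₀ ℕ}
    (hb : b ∈ border O) : b ∉ O := by
  rcases hb with ⟨rfl, -⟩ | ⟨-, hb, -⟩
  · simp
  · exact hb

/-- Every monomial outside a divisor-closed set is divisible by a border monomial. -/
theorem exists_mem_border_le {n : ℕ} {O : Set (Fin n →₀ ℕ)}
    (hO : ∀ β ∈ O, ∀ α : Fin n →₀ ℕ, α ≤ β → α ∈ O) (d : Fin n →₀ ℕ) (hd : d ∉ O) :
    ∃ b ∈ border O, b ≤ d := by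
  by_cases hne : O = ∅
  · exact ⟨0, Or.inl ⟨hne, rfl⟩, zero_le⟩
  induction d using WellFoundedLT.induction with
  | ind d ih =>
    obtain ⟨β, hβ⟩ := Set.nonempty_iff_ne_empty.mpr hne
    have hd0 : d ≠ 0 := by
      rintro rfl
      exact hd (hO β hβ 0 (zero_le))
    obtain ⟨i, hi⟩ := Finsupp.ne_iff.mp hd0
    have hle : Finsupp.single i 1 ≤ d :=
      Finsupp.single_le_iff.mpr (Nat.one_le_iff_ne_zero.mpr hi)
    have hsub : d - Finsupp.single i 1 + Finsupp.single i 1 = d := tsub_add_cancel_of_le hle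
    by_cases hmem : d - Finsupp.single i 1 ∈ O
    · exact ⟨d, Or.inr ⟨hne, hd, i, _, hmem, hsub.symm⟩, le_rfl⟩
    · have hlt : d - Finsupp.single i 1 < d := by
        refine lt_of_le_of_ne tsub_le_self fun h => ?_
        rw [h] at hsub
        simp at hsub
      obtain ⟨b, hb, hbd⟩ := ih _ hlt hmem
      exact ⟨b, hb, hbd.trans tsub_le_self⟩

theorem monomial_mem_of_le {n : ℕ} {k : Type*} [CommSemiring k]
    {J : Ideal (MvPolynomial (Fin n) k)} {α β : Fin n →₀ ℕ} (h : α ≤ β)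
    (hα : monomial α (1 : k) ∈ J) : monomial β (1 : k) ∈ J := by
  have hmul : monomial β (1 : k) = monomial (β - α) 1 * monomial α 1 := by
    rw [monomial_mul, tsub_add_cancel_of_le h, one_mul]
  rw [hmul]
  exact J.mul_mem_left _ hα

theorem monomial_leadMonomial_mem_leadingTermIdeal {n : ℕ} {k : Type*} [Field k]
    (m : MonomialOrder (Fin n)) {I : Ideal (MvPolynomial (Fin n) k)}
    {f : MvPolynomial (Fin n) k} (hf : f ∈ I) (h0 : f ≠ 0) :
    monomial (leadMonomial m f) (1 : k) ∈ leadingTermIdeal m I :=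
  Ideal.subset_span ⟨f, hf, h0, rfl⟩

/-- An element of `I` of the form `b - ∑ cᵢ tᵢ` with `b ∉ O_≤(I)` and all `tᵢ ∈ O_≤(I)` is
nonzero with leading monomial `b`. -/
theorem leadMonomial_eq_of_support_sub_subset {n : ℕ} {k : Type*} [Field k]
    (m : MonomialOrder (Fin n)) {I : Ideal (MvPolynomial (Fin n) k)}
    {f : MvPolynomial (Fin n) k} {b : Fin n →₀ ℕ} (hb : b ∉ complementLT m I)
    (hs : ↑(f - monomial b (1 : k)).support ⊆ complementLT m I) (hf : f ∈ I) :
    f ≠ 0 ∧ leadMonomial m f = b := by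
  have hcoeff : coeff b (f - monomial b (1 : k)) = 0 := by
    by_contra h
    exact hb (hs (mem_support_iff.mpr h))
  have hf0 : f ≠ 0 := by
    rintro rfl
    simp at hcoeff
  refine ⟨hf0, ?_⟩
  by_contra hne
  have hlead : coeff (leadMonomial m f) f ≠ 0 :=
    mem_support_iff.mp (m.degree_mem_support hf0)
  have hmem : leadMonomial m f ∈ complementLT m I := by
    refine hs (mem_support_iff.mpr ?_)
    rwa [coeff_sub, coeff_monomial, if_neg (Ne.symm hne), sub_zero]
  exact hmem (monomial_leadMonomial_mem_leadingTermIdeal m hf hf0)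

/-- let `≤` be a monomial order, `𝔞 ⊆ k[x₁,…,xₙ]` a proper
zero-dimensional ideal, and `O = O_≤(𝔞)`.  If `B` is the `O`-border basis of `𝔞`, then
`B` is a Gröbner basis of `𝔞` with respect to `≤`: the ideal generated by
`{LM_≤(g) : g ∈ B}` equals `LT_≤(𝔞)`. -/
theorem border_basis_is_groebner_basis
    {n : ℕ} (k : Type*) [Field k] (m : MonomialOrder (Fin n))
    (I : Ideal (MvPolynomial (Fin n) k)) (hproper : I ≠ ⊤)
    (h0 : FiniteDimensional k (MvPolynomial (Fin n) k ⧸ I))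
    (B : Set (MvPolynomial (Fin n) k))
    (hB : IsBorderBasis k (complementLT m I) I B) :
    Ideal.span {p | ∃ g ∈ B, p = (monomial (leadMonomial m g) (1 : k) :
      MvPolynomial (Fin n) k)} = leadingTermIdeal m I := by
  obtain ⟨g, ⟨hg, -, -⟩, rfl⟩ := hB
  have hlead : ∀ b ∈ border (complementLT m I), g b ≠ 0 ∧ leadMonomial m (g b) = b :=
    fun b hb => leadMonomial_eq_of_support_sub_subset m (notMem_of_mem_border hb)
      (hg b hb).1 (hg b hb).2
  apply le_antisymm
  · refine Ideal.span_le.mpr ?_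
    rintro _ ⟨_, ⟨b, hb, rfl⟩, rfl⟩
    exact monomial_leadMonomial_mem_leadingTermIdeal m (hg b hb).2 (hlead b hb).1
  · refine Ideal.span_le.mpr ?_
    rintro _ ⟨f, hf, hf0, rfl⟩
    obtain ⟨b, hb, hbd⟩ := exists_mem_border_le (O := complementLT m I)
      (fun β hβ α hαβ hα => hβ (monomial_mem_of_le hαβ hα)) (leadMonomial m f)
      (fun h => h (monomial_leadMonomial_mem_leadingTermIdeal m hf hf0))
    refine monomial_mem_of_le hbd (Ideal.subset_span ⟨g b, ⟨b, hb, rfl⟩, ?_⟩)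
    rw [(hlead b hb).2]
end
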